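/- Let Γ ≥ 1 be a natural number and μ' > 0, C_B ≥ 0, C_V ≥ 0 be reals. For each natural t set η_t = 1/√(Γ·(t+1)), and assume μ'·η_t ≤ 1 for all t. Let (Δ_t)_{t≥0} and (V_t)_{t≥0} be real sequences with Δ_t ≥ 0, 0 ≤ V_t ≤ C_V/(t+1), and Δ_{t+1} ≤ (1 − η_t·μ')·Δ_t + η_t·C_B + V_t for all t. Then there exists a constant C > 0 (depending only on μ' and Γ) such that for every natural number T ≥ 1: Δ_T ≤ Δ_0 · exp(−(2μ'/√Γ)·(√(T+1) − 1)) + C_B/μ' + (4·C_V·√Γ)/(μ'·√(T+1)) + C·C_V/(T+1). -/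

import Mathlib

noncomputable def auxW (a : ℝ) : ℕ → ℝ
  | 0 => 0
  | (t+1) => (1 - a / Real.sqrt (t+1)) * auxW a t + 1 / (t+1)

lemma aux_step (a C r q : ℝ) (ha : 0 < a) (hC : 0 ≤ C) (hr : 1 ≤ r) (hq : 0 < q)
    (hqr : q^2 = r^2 + 1) (har : 1 ≤ a * r) :
    (1 - a / r) * (4 / (a * r) + C / r^2) + 1 / r^2 ≤ 4 / (a * q) + C / q^2 := by
  have hr0 : 0 < r := by linarith
  have h1 : (1 - a / r) * (C / r^2) ≤ C / q^2 := by
    have e : C / q^2 - (1 - a / r) * (C / r^2) = C * (a * r^2 + a - r) / (r^3 * q^2) := by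
      rw [hqr]
      have : r^2 + 1 ≠ 0 := by positivity
      field_simp
      ring
    have : 0 ≤ C * (a * r^2 + a - r) / (r^3 * q^2) := by
      apply div_nonneg (mul_nonneg hC _) (by positivity)
      nlinarith
    linarith
  have hrq : r ≤ q := by nlinarith
  have h2 : 1 / r - 1 / q ≤ a / (2 * r^2) := by
    have e : 1 / r - 1 / q = 1 / (r * q * (q + r)) := by
      field_simp
      nlinarith
    rw [e, div_le_div_iff₀ (by positivity) (by positivity)]
    have : 2 * r ≤ q * (q + r) * a := by
      have h3 : r * (2 * r) ≤ q * (q + r) := by nlinarith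
      have h4 : r * (2 * r) * a ≤ q * (q + r) * a := by gcongr
      nlinarith
    nlinarith
  have h3 : (1 - a / r) * (4 / (a * r)) + 1 / r^2 ≤ 4 / (a * q) := by
    have e : (1 - a / r) * (4 / (a * r)) + 1 / r^2 = 4 / a * (1 / r) - 3 / r^2 := by
      field_simp; ring
    have e2 : 4 / (a * q) = 4 / a * (1 / q) := by field_simp
    have e3 : 4 / a * (1 / r - 1 / q) ≤ 4 / a * (a / (2 * r^2)) := by gcongr
    have e4 : 4 / a * (a / (2 * r^2)) = 2 / r^2 := by field_simp; norm_num
    have e5 : 2 / r^2 ≤ 3 / r^2 := by gcongr; norm_num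
    rw [e, e2]; linarith
  linarith [mul_add (1 - a / r) (4 / (a * r)) (C / r^2)]

lemma aux_fac (a : ℝ) (ha : 0 < a) (ha1 : a ≤ 1) (t : ℕ) :
    1 ≤ Real.sqrt (t+1) ∧ 0 ≤ 1 - a / Real.sqrt (t+1) ∧ 1 - a / Real.sqrt (t+1) ≤ 1 := by
  have h : 1 ≤ Real.sqrt (t+1) := by
    rw [Real.one_le_sqrt]; linarith [(Nat.cast_nonneg t : (0:ℝ) ≤ t)]
  refine ⟨h, ?_, ?_⟩
  · have : a / Real.sqrt (t+1) ≤ 1 := by rw [div_le_one (by linarith)]; linarith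
    linarith
  · have : 0 ≤ a / Real.sqrt (t+1) := by positivity
    linarith

lemma auxW_bd (a : ℝ) (ha : 0 < a) (ha1 : a ≤ 1) (t : ℕ) : 0 ≤ auxW a t ∧ auxW a t ≤ t := by
  induction t with
  | zero => simp [auxW]
  | succ t ih =>
    obtain ⟨h1, h2, h3⟩ := aux_fac a ha ha1 t
    have h4 : (1:ℝ) / (t+1) ≤ 1 := by
      rw [div_le_one (by positivity)]; linarith [(Nat.cast_nonneg t : (0:ℝ) ≤ t)]
    have h5 : (0:ℝ) ≤ 1 / (t+1) := by positivity
    have h6 := mul_nonneg h2 ih.1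
    have h7 := mul_le_mul_of_nonneg_right h3 ih.1
    simp only [auxW]
    push_cast
    constructor <;> linarith [ih.2]

lemma auxW_le (a : ℝ) (ha : 0 < a) (ha1 : a ≤ 1) (t : ℕ) :
    auxW a t ≤ 4 / (a * Real.sqrt (t+1)) + (2 / a^4) / (t+1) := by
  induction t with
  | zero => simp only [auxW]; positivity
  | succ t ih =>
    obtain ⟨h1, h2, h3⟩ := aux_fac a ha ha1 t
    have hs : Real.sqrt (t+1) ^ 2 = (t:ℝ)+1 := Real.sq_sqrt (by positivity)
    have hq : Real.sqrt (((t+1 : ℕ):ℝ)+1) ^ 2 = ((t+1:ℕ):ℝ)+1 := Real.sq_sqrt (by positivity)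
    by_cases h : 1 ≤ a * Real.sqrt (t+1)
    · have := aux_step a (2 / a^4) (Real.sqrt (t+1)) (Real.sqrt (((t+1 : ℕ):ℝ)+1)) ha
        (by positivity) h1 (Real.sqrt_pos.2 (by positivity)) (by rw [hs, hq]; push_cast; ring) h
      rw [hs, hq] at this
      refine le_trans ?_ this
      simp only [auxW]
      gcongr
    · push Not at h
      have hb := (auxW_bd a ha ha1 (t+1)).2
      have h5 : a^2 * ((t:ℝ)+1) ≤ 1 := by
        rw [← hs, ← mul_pow]
        exact pow_le_one₀ (by positivity) h.le
      have h6 : ((t+1:ℕ):ℝ) ≤ (2 / a^4) / (((t+1:ℕ):ℝ)+1) := by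
        rw [le_div_iff₀ (by positivity), le_div_iff₀ (by positivity)]
        push_cast
        have ht : (0:ℝ) ≤ t := Nat.cast_nonneg t
        have h7 : (a^2 * ((t:ℝ)+1)) * (a^2 * ((t:ℝ)+1)) ≤ 1 := by
          apply mul_le_one₀ h5 (by positivity) h5
        have h8 : ((t:ℝ)+1) * ((t:ℝ)+1+1) * a^4 ≤ ((t:ℝ)+1) * (2*((t:ℝ)+1)) * a^4 := by
          gcongr; linarith
        nlinarith
      have : 0 ≤ 4 / (a * Real.sqrt (((t+1 : ℕ):ℝ)+1)) := by positivity
      linarith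

lemma aux_exp (a : ℝ) (ha : 0 < a) (t : ℕ) :
    (1 - a / Real.sqrt (t+1)) * Real.exp (-(2*a) * (Real.sqrt (t+1) - 1)) ≤
      Real.exp (-(2*a) * (Real.sqrt (((t+1:ℕ):ℝ)+1) - 1)) := by
  set r := Real.sqrt ((t:ℝ)+1) with hr
  set q := Real.sqrt (((t+1:ℕ):ℝ)+1) with hq
  have hr0 : 0 < r := Real.sqrt_pos.2 (by positivity)
  have hr2 : r^2 = (t:ℝ)+1 := Real.sq_sqrt (by positivity)
  have hq2 : q^2 = ((t+1:ℕ):ℝ)+1 := Real.sq_sqrt (by positivity)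
  push_cast at hq2
  have h1 : 1 - a / r ≤ Real.exp (-(a/r)) := by
    have := Real.add_one_le_exp (-(a/r)); linarith
  have h2 : 2 * (q - r) ≤ 1 / r := by
    rw [le_div_iff₀ hr0]; nlinarith [sq_nonneg (q - r)]
  calc _ ≤ Real.exp (-(a/r)) * Real.exp (-(2*a) * (r - 1)) := by gcongr
    _ = Real.exp (-(a/r) + -(2*a) * (r - 1)) := (Real.exp_add _ _).symm
    _ ≤ _ := by
      apply Real.exp_le_exp.2
      have := mul_le_mul_of_nonneg_left h2 ha.le
      have e : a * (1 / r) = a / r := by ring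
      rw [e] at this
      linarith

/-- Deterministic core of Theorem 1 (Global Convergence Rate under Heterogeneous
Sparsity). -/
theorem global_convergence_rate (Γ : ℕ) (hΓ : 1 ≤ Γ) (μ' : ℝ) (hμ' : 0 < μ')
    (η : ℕ → ℝ) (hη : ∀ t : ℕ, η t = 1 / Real.sqrt ((Γ : ℝ) * (t + 1)))
    (hμη : ∀ t : ℕ, μ' * η t ≤ 1) :
    ∃ C : ℝ, 0 < C ∧
      ∀ (CB CV : ℝ), 0 ≤ CB → 0 ≤ CV →
      ∀ (Δ V : ℕ → ℝ),
        (∀ t, 0 ≤ Δ t) →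
        (∀ t, 0 ≤ V t ∧ V t ≤ CV / (t + 1)) →
        (∀ t, Δ (t + 1) ≤ (1 - η t * μ') * Δ t + η t * CB + V t) →
        ∀ T : ℕ, 1 ≤ T →
          Δ T ≤ Δ 0 * Real.exp (-(2 * μ' / Real.sqrt Γ) * (Real.sqrt (T + 1) - 1))
              + CB / μ'
              + (4 * CV * Real.sqrt Γ) / (μ' * Real.sqrt (T + 1))
              + C * CV / (T + 1) := by

  have hG : (0:ℝ) < Γ := by exact_mod_cast hΓ
  have hsG : 0 < Real.sqrt Γ := Real.sqrt_pos.2 hG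
  obtain ⟨a, hadef⟩ : ∃ a, a = μ' / Real.sqrt Γ := ⟨_, rfl⟩
  have ha : 0 < a := by rw [hadef]; positivity
  have hηa : ∀ t : ℕ, η t * μ' = a / Real.sqrt (t+1) := by
    intro t
    have : 0 < Real.sqrt ((t:ℝ)+1) := Real.sqrt_pos.2 (by positivity)
    rw [hη, Real.sqrt_mul hG.le, hadef]
    field_simp
  have ha1 : a ≤ 1 := by
    have h := hηa 0
    have h' := hμη 0
    simp at h
    linarith
  refine ⟨2 / a^4, by positivity, ?_⟩
  intro CB CV hCB hCV Δ V hΔ hV hrec T _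
  have key : ∀ t : ℕ, Δ t ≤ Δ 0 * Real.exp (-(2*a) * (Real.sqrt (t+1) - 1))
      + CB / μ' + CV * auxW a t := by
    intro t
    induction t with
    | zero =>
      have : 0 ≤ CB / μ' := by positivity
      simp [auxW, this]
    | succ t ih =>
      obtain ⟨h1, h2, h3⟩ := aux_fac a ha ha1 t
      have hE := mul_le_mul_of_nonneg_left (aux_exp a ha t) (hΔ 0)
      have hr := hrec t
      have hηt : η t * CB = a / Real.sqrt (t+1) * (CB / μ') := by
        rw [← hηa]; field_simp
      rw [hηa, hηt] at hr
      have hi := mul_le_mul_of_nonneg_left ih h2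
      have hv := (hV t).2
      have e : CV / ((t:ℝ)+1) = CV * (1 / (t+1)) := by ring
      rw [e] at hv
      simp only [auxW]
      nlinarith
  have hW := mul_le_mul_of_nonneg_left (auxW_le a ha ha1 T) hCV
  have hT := key T
  have e1 : 2 * μ' / Real.sqrt Γ = 2 * a := by rw [hadef]; ring
  have hsT : 0 < Real.sqrt ((T:ℝ)+1) := Real.sqrt_pos.2 (by positivity)
  have e2 : (4 * CV * Real.sqrt Γ) / (μ' * Real.sqrt (T + 1))
      = CV * (4 / (a * Real.sqrt (T+1))) := by
    rw [hadef]; field_simp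
  have e3 : 2 / a^4 * CV / ((T:ℝ)+1) = CV * ((2 / a^4) / (T+1)) := by ring
  rw [e1, e2, e3]
  linarith
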